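/- arXiv:2112.14637 — 2 statements merged into one kernel-verified Lean document; each statement's English description precedes it below -/
import Mathlib

section
/- Let s be a maximal exceptional sequence with l := 2ℓ₂ − H(s) > 0, and let b̲ be the minimal second coordinate of its points. Then for every h with ℓ₂ − l ≤ h ≤ ℓ₂ − 1, the set of points of s on the line y = b̲ + h is a horizontal chain, i.e., consists of exactly ℓ₁ consecutive lattice points. -/
/-- The immaculate locus `I(ℓ₁,ℓ₂;α,β) ⊆ ℤ²`: union of the horizontal strip
`𝓗 = {(a,b) : 0 < b < ℓ₂}` and the parallelogram
`𝓟 = {(a,b) : −β < a < ℓ₁ and 0 < a + αb < ℓ₁ − β + αℓ₂}`. -/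
def Imm (l1 l2 α β : ℤ) : Set (ℤ × ℤ) :=
  {p | (0 < p.2 ∧ p.2 < l2) ∨
    (-β < p.1 ∧ p.1 < l1 ∧ 0 < p.1 + α * p.2 ∧ p.1 + α * p.2 < l1 - β + α * l2)}

/-- A finite sequence `s₀, …, s_N` in `ℤ²` is exceptional if `s_j − s_i ∈ I`
for all `0 ≤ i < j ≤ N`. -/
def Exceptional (l1 l2 α β : ℤ) {N : ℕ} (s : Fin (N + 1) → ℤ × ℤ) : Prop :=
  ∀ i j : Fin (N + 1), i < j → s j - s i ∈ Imm l1 l2 α β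

/-- Vertical lexicographic order on `ℤ²`. -/
def vlex (p q : ℤ × ℤ) : Prop := p.2 < q.2 ∨ (p.2 = q.2 ∧ p.1 < q.1)

/-- Horizontal lexicographic order on `ℤ²`. -/
def hlex (p q : ℤ × ℤ) : Prop := p.1 < q.1 ∨ (p.1 = q.1 ∧ p.2 < q.2)

/-- An exceptional sequence is vertically orderable if listing its underlying set
in the vertical lexicographic order again yields an exceptional sequence. -/
def VertOrderable (l1 l2 α β : ℤ) {N : ℕ} (s : Fin (N + 1) → ℤ × ℤ) : Prop :=
  ∀ p ∈ Set.range s, ∀ q ∈ Set.range s, vlex p q → q - p ∈ Imm l1 l2 α β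

/-- Horizontally orderable: as above with the roles of the coordinates exchanged. -/
def HorOrderable (l1 l2 α β : ℤ) {N : ℕ} (s : Fin (N + 1) → ℤ × ℤ) : Prop :=
  ∀ p ∈ Set.range s, ∀ q ∈ Set.range s, hlex p q → q - p ∈ Imm l1 l2 α β

/-- Height `H(s) = (max b) − (min b) + 1` of a sequence in `ℤ²`. -/
noncomputable def heightSeq {N : ℕ} (s : Fin (N + 1) → ℤ × ℤ) : ℤ :=
  (Finset.univ.sup' Finset.univ_nonempty fun i => (s i).2) -
    (Finset.univ.inf' Finset.univ_nonempty fun i => (s i).2) + 1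

/-- Width `W(s) = (max a) − (min a) + 1` of a sequence in `ℤ²`. -/
noncomputable def widthSeq {N : ℕ} (s : Fin (N + 1) → ℤ × ℤ) : ℤ :=
  (Finset.univ.sup' Finset.univ_nonempty fun i => (s i).1) -
    (Finset.univ.inf' Finset.univ_nonempty fun i => (s i).1) + 1

/-- The lattice `L = ℤ·(ℓ₁,0) ⊕ ℤ·(−β,ℓ₂) ⊆ ℤ²`. -/
def ImmLat (l1 l2 β : ℤ) : Set (ℤ × ℤ) := {p | ∃ m n : ℤ, p = (m * l1 - n * β, n * l2)}

/-- The lattice `L` avoids the immaculate locus. -/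
theorem notMem_imm_of_mem_immLat {l1 l2 α β : ℤ} (hl1 : 0 < l1) (hl2 : 0 < l2)
    (hβ0 : 0 ≤ β) (hβ : β ≤ α * l2) {p : ℤ × ℤ} (hp : p ∈ ImmLat l1 l2 β) :
    p ∉ Imm l1 l2 α β := by
  obtain ⟨m, n, rfl⟩ := hp
  rintro (⟨h1, h2⟩ | ⟨h1, h2, h3, h4⟩)
  · have hn : 0 < n := pos_of_mul_pos_left h1 hl2.le
    nlinarith
  · dsimp only at h1 h2 h3 h4
    rcases le_or_gt n 0 with hn | hn
    · have hm : m < 1 := by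
        by_contra! hm
        nlinarith
      nlinarith [mul_nonneg (neg_nonneg.2 hn) (sub_nonneg.2 hβ)]
    · have hm : 0 < m := by
        by_contra! hm
        nlinarith
      nlinarith [mul_nonneg (sub_nonneg.2 (Int.add_one_le_iff.2 hn)) (sub_nonneg.2 hβ)]

theorem neg_mem_immLat {l1 l2 β : ℤ} {p : ℤ × ℤ} (hp : p ∈ ImmLat l1 l2 β) :
    -p ∈ ImmLat l1 l2 β := by
  obtain ⟨m, n, rfl⟩ := hp
  exact ⟨-m, -n, by ext <;> simp <;> ring⟩

/-- The representative of a point modulo `L` in the box `[0, ℓ₁) × [0, ℓ₂)`. -/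
def immLatRep (l1 l2 β : ℤ) (p : ℤ × ℤ) : ℤ × ℤ :=
  ((p.1 + p.2 / l2 * β) % l1, p.2 % l2)

theorem sub_mem_immLat_of_immLatRep_eq {l1 l2 β : ℤ} {p q : ℤ × ℤ}
    (h : immLatRep l1 l2 β p = immLatRep l1 l2 β q) : q - p ∈ ImmLat l1 l2 β := by
  obtain ⟨h1, h2⟩ := Prod.ext_iff.1 h
  dsimp only [immLatRep] at h1 h2
  have e1 := Int.emod_add_mul_ediv (p.1 + p.2 / l2 * β) l1
  have e2 := Int.emod_add_mul_ediv (q.1 + q.2 / l2 * β) l1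
  have e3 := Int.emod_add_mul_ediv p.2 l2
  have e4 := Int.emod_add_mul_ediv q.2 l2
  refine ⟨(q.1 + q.2 / l2 * β) / l1 - (p.1 + p.2 / l2 * β) / l1, q.2 / l2 - p.2 / l2, ?_⟩
  ext
  · simp only [Prod.fst_sub]
    linear_combination e1 - e2 - h1
  · simp only [Prod.snd_sub]
    linear_combination e3 - e4 - h2

/-- A maximal exceptional sequence meets every class modulo `L`. -/
theorem Exceptional.exists_sub_mem_immLat {l1 l2 α β : ℤ} (hl1 : 0 < l1) (hl2 : 0 < l2)
    (hβ0 : 0 ≤ β) (hβ : β ≤ α * l2) {N : ℕ} (hN : (N : ℤ) + 1 = l1 * l2)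
    {s : Fin (N + 1) → ℤ × ℤ} (hs : Exceptional l1 l2 α β s) (p : ℤ × ℤ) :
    ∃ i, s i - p ∈ ImmLat l1 l2 β := by
  have hmaps : ∀ q : ℤ × ℤ,
      immLatRep l1 l2 β q ∈ Finset.Ico (0 : ℤ) l1 ×ˢ Finset.Ico (0 : ℤ) l2 := fun q => by
    simp only [immLatRep, Finset.mem_product, Finset.mem_Ico]
    exact ⟨⟨Int.emod_nonneg _ hl1.ne', Int.emod_lt_of_pos _ hl1⟩,
      Int.emod_nonneg _ hl2.ne', Int.emod_lt_of_pos _ hl2⟩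
  have hinj : Function.Injective fun i => immLatRep l1 l2 β (s i) := by
    intro i j hij
    have hL := sub_mem_immLat_of_immLatRep_eq hij
    rcases lt_trichotomy i j with hlt | heq | hlt
    · exact absurd (hs i j hlt) (notMem_imm_of_mem_immLat hl1 hl2 hβ0 hβ hL)
    · exact heq
    · refine absurd (hs j i hlt) (notMem_imm_of_mem_immLat hl1 hl2 hβ0 hβ ?_)
      simpa using neg_mem_immLat hL
  have hcard : (Finset.Ico (0 : ℤ) l1 ×ˢ Finset.Ico (0 : ℤ) l2).card ≤
      (Finset.univ : Finset (Fin (N + 1))).card := by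
    rw [Finset.card_product, Int.card_Ico, Int.card_Ico, Finset.card_univ, Fintype.card_fin]
    zify
    rw [sub_zero, sub_zero, Int.toNat_of_nonneg hl1.le, Int.toNat_of_nonneg hl2.le, hN]
  obtain ⟨i, -, hi⟩ := Finset.surjOn_of_injOn_of_card_le _ (fun i _ => hmaps (s i))
    hinj.injOn hcard (hmaps p)
  exact ⟨i, sub_mem_immLat_of_immLatRep_eq hi.symm⟩

/-- Two points of an exceptional sequence on a horizontal line are less than `ℓ₁` apart. -/
theorem Exceptional.fst_sub_lt {l1 l2 α β : ℤ} (hl1 : 0 < l1) {N : ℕ}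
    {s : Fin (N + 1) → ℤ × ℤ} (hs : Exceptional l1 l2 α β s) {i j : Fin (N + 1)}
    (hij : (s i).2 = (s j).2) : (s j).1 - (s i).1 < l1 := by
  rcases lt_trichotomy i j with hlt | rfl | hlt
  · rcases hs i j hlt with h | h
    · simp [hij] at h
    · exact h.2.1
  · simpa using hl1
  · rcases hs j i hlt with h | h
    · simp [hij] at h
    · have h3 := h.2.2.1
      simp only [Prod.fst_sub, Prod.snd_sub, hij, sub_self, mul_zero, add_zero] at h3
      linarith

/-- for a maximal exceptional sequence with `l := 2ℓ₂ − H(s) > 0`, the points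
of `s` on the line `y = b̲ + h` form a horizontal chain for `ℓ₂ − l ≤ h ≤ ℓ₂ − 1`. -/
theorem stmt_8 (l1 l2 α β : ℤ) (hl1 : 2 ≤ l1) (hl2 : 2 ≤ l2)
    (hα : 0 ≤ α) (hαβ : α ≤ β) (hβ : β ≤ α * (l2 - 1))
    (N : ℕ) (hN : (N : ℤ) + 1 = l1 * l2)
    (s : Fin (N + 1) → ℤ × ℤ) (hs : Exceptional l1 l2 α β s)
    (hl : 0 < 2 * l2 - heightSeq s) :
    ∀ h : ℤ, l2 - (2 * l2 - heightSeq s) ≤ h → h ≤ l2 - 1 →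
      ∃ x : ℤ,
        {p ∈ Set.range s |
            p.2 = (Finset.univ.inf' Finset.univ_nonempty fun i => (s i).2) + h} =
          {p : ℤ × ℤ |
            p.2 = (Finset.univ.inf' Finset.univ_nonempty fun i => (s i).2) + h ∧
              x ≤ p.1 ∧ p.1 < x + l1} := by
  intro h h1 h2
  have hβ0 : 0 ≤ β := hα.trans hαβ
  have hβ' : β ≤ α * l2 := by linarith
  have hl1' : 0 < l1 := by linarith
  have hl2' : 0 < l2 := by linarith
  set b := Finset.univ.inf' Finset.univ_nonempty fun i => (s i).2 with hb
  have hmin : ∀ i, b ≤ (s i).2 := fun i =>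
    Finset.inf'_le (fun i => (s i).2) (Finset.mem_univ i)
  have hmax : ∀ i, (s i).2 < b + heightSeq s := fun i => by
    have := Finset.le_sup' (fun i => (s i).2) (Finset.mem_univ i)
    simp only [heightSeq, ← hb]
    linarith
  have hrow : ∀ a : ℤ, ∃ i, ∃ m : ℤ, s i = (a + m * l1, b + h) := fun a => by
    obtain ⟨i, m, n, hi⟩ := hs.exists_sub_mem_immLat hl1' hl2' hβ0 hβ' hN (a, b + h)
    obtain ⟨hi1, hi2⟩ := Prod.ext_iff.1 hi
    simp only [Prod.fst_sub, Prod.snd_sub] at hi1 hi2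
    have hn : n = 0 := by
      have := hmin i
      have := hmax i
      have : n < 1 := by
        by_contra! hn
        nlinarith
      have : -1 < n := by
        by_contra! hn
        nlinarith
      omega
    subst hn
    exact ⟨i, m, Prod.ext (by linarith) (by linarith)⟩
  obtain ⟨i₀, m₀, hi₀⟩ := hrow 0
  obtain ⟨i, hi, hleast⟩ := (Finset.univ.filter fun i => (s i).2 = b + h).exists_min_image
    (fun i => (s i).1) ⟨i₀, by simp [hi₀]⟩
  simp only [Finset.mem_filter, Finset.mem_univ, true_and] at hi hleast
  refine ⟨(s i).1, Set.ext fun p => ⟨?_, ?_⟩⟩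
  · rintro ⟨⟨j, rfl⟩, hj⟩
    have := hs.fst_sub_lt hl1' (hi.trans hj.symm)
    exact ⟨hj, hleast j hj, by linarith⟩
  · rintro ⟨hp, hp1, hp2⟩
    obtain ⟨j, m, hj⟩ := hrow p.1
    have hj2 : (s j).2 = b + h := by rw [hj]
    have hlo := hleast j hj2
    have hhi := hs.fst_sub_lt hl1' (hi.trans hj2.symm)
    simp only [hj] at hlo hhi
    have hm : m = 0 := by
      have : m < 1 := by
        by_contra! hm
        nlinarith
      have : -1 < m := by
        by_contra! hm
        nlinarith
      omega
    exact ⟨⟨j, by rw [hj, hm]; ext <;> simp [hp]⟩, hp⟩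
end

section
/- In the product case (α = β = 0), every maximal exceptional sequence is vertically orderable or horizontally orderable. -/
theorem Exceptional.trichotomy_of_product {l1 l2 : ℤ} {N : ℕ} {s : Fin (N + 1) → ℤ × ℤ}
    (hs : Exceptional l1 l2 0 0 s) (i j : Fin (N + 1)) :
    ((i : ℕ) < j ∧ 0 < (s j).2 - (s i).2 ∧ (s j).2 - (s i).2 < l2) ∨
    ((i : ℕ) < j ∧ 0 < (s j).1 - (s i).1 ∧ (s j).1 - (s i).1 < l1) ∨
    ((j : ℕ) < i ∧ 0 < (s i).2 - (s j).2 ∧ (s i).2 - (s j).2 < l2) ∨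
    ((j : ℕ) < i ∧ 0 < (s i).1 - (s j).1 ∧ (s i).1 - (s j).1 < l1) ∨
    ((i : ℕ) = j ∧ (s i).1 = (s j).1 ∧ (s i).2 = (s j).2) := by
  rcases lt_trichotomy i j with h | h | h
  · have := hs i j h
    simp only [Imm, Set.mem_ofPred_eq, Prod.fst_sub, Prod.snd_sub] at this
    have h' : (i : ℕ) < j := h
    omega
  · subst h
    simp
  · have := hs j i h
    simp only [Imm, Set.mem_ofPred_eq, Prod.fst_sub, Prod.snd_sub] at this
    have h' : (j : ℕ) < i := h
    omega

/-- in the product case every maximal exceptional sequence is vertically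
or horizontally orderable. -/
theorem stmt_13 (l1 l2 : ℤ) (hl1 : 2 ≤ l1) (hl2 : 2 ≤ l2)
    (N : ℕ) (hN : (N : ℤ) + 1 = l1 * l2)
    (s : Fin (N + 1) → ℤ × ℤ) (hs : Exceptional l1 l2 0 0 s) :
    VertOrderable l1 l2 0 0 s ∨ HorOrderable l1 l2 0 0 s := by
  by_contra hcon
  simp only [VertOrderable, HorOrderable, not_or, not_forall] at hcon
  obtain ⟨⟨_, ⟨p, rfl⟩, _, ⟨q, rfl⟩, hpq, hv⟩, ⟨_, ⟨m, rfl⟩, _, ⟨n, rfl⟩, hmn, hh⟩⟩ := hcon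
  simp only [Imm, vlex, hlex, Set.mem_ofPred_eq, Prod.fst_sub, Prod.snd_sub] at hpq hv hmn hh
  have hpq' : (q : ℕ) < p ∧ l2 ≤ (s q).2 - (s p).2 ∧ 0 < (s p).1 - (s q).1 ∧
      (s p).1 - (s q).1 < l1 := by
    have := Exceptional.trichotomy_of_product hs p q
    omega
  have hmn' : (n : ℕ) < m ∧ l1 ≤ (s n).1 - (s m).1 ∧ 0 < (s m).2 - (s n).2 ∧
      (s m).2 - (s n).2 < l2 := by
    have := Exceptional.trichotomy_of_product hs m n
    omega
  clear hpq hv hmn hh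
  rcases Exceptional.trichotomy_of_product hs p m with h1 | h1 | h1 | h1 | h1 <;>
  rcases Exceptional.trichotomy_of_product hs q n with h2 | h2 | h2 | h2 | h2 <;>
  first
  | omega
  | (rcases Exceptional.trichotomy_of_product hs p n with h3 | h3 | h3 | h3 | h3 <;>
    first
    | omega
    | (rcases Exceptional.trichotomy_of_product hs q m with h4 | h4 | h4 | h4 | h4 <;> omega))
end
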